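/- Let X be a Polish space, P a point process on X of first order and q ∈ (0,1). If the splitting kernel of P does not depend on the observed configuration, i.e. there exists a point process Q_q with Υ^ν_q(P) = Q_q for Γ_q(P)-almost all ν ∈ M··(X), then P is a Poisson point process (namely P = Π_{ν_P}, and Q_q = Γ_{1−q}(P) = Π_{(1−q)ν_P}). -/

import Mathlib

open MeasureTheory ENNReal

noncomputable section

namespace PoissonSplitting

variable {X : Type*} [MeasurableSpace X] [MetricSpace X]

/-- `expNeg a = e^{-a}` for an extended nonnegative real `a`. -/
def expNeg (a : ℝ≥0∞) : ℝ≥0∞ := if a = ∞ then 0 else ENNReal.ofReal (Real.exp (-a.toReal))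

/-- A (Radon) point measure on `X`: a locally finite countable sum of Dirac measures. -/
def IsPointMeasure (μ : Measure X) : Prop :=
  (∃ D : ℕ → Option X, μ = Measure.sum fun n => (D n).elim 0 Measure.dirac) ∧
    IsLocallyFiniteMeasure μ

/-- The class `U` of nonnegative bounded measurable functions on `X` whose support is
contained in some bounded set. -/
def MemU (f : X → ℝ) : Prop :=
  Measurable f ∧ (∀ x, 0 ≤ f x) ∧ (∃ C, ∀ x, f x ≤ C) ∧
    Bornology.IsBounded (Function.support f)

/-- The pairing `ζ_f(ν) = ν(f)`, as an extended nonnegative real. -/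
def pairing (f : X → ℝ) (ν : Measure X) : ℝ≥0∞ := ∫⁻ x, ENNReal.ofReal (f x) ∂ν

/-- The Laplace transform of a law `P` on measures: `L_P(f) = ∫ e^{-ν(f)} P(dν)`. -/
def laplaceT (P : Measure (Measure X)) (f : X → ℝ) : ℝ≥0∞ := ∫⁻ ν, expNeg (pairing f ν) ∂P

/-- `T` is the independent `q`-thinning `T^μ_q` of the point measure `μ`:
the probability law, supported on point-measure subconfigurations of `μ`, whose Laplace
transform on test functions `f ∈ U` is
`T(e^{-ζ_f}) = ∏_{x∈μ}(1-q+q e^{-f(x)})^{μ({x})} = exp(∫ log(1-q+q e^{-f}) dμ)`. -/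
def IsThinning (q : ℝ) (μ : Measure X) (T : Measure (Measure X)) : Prop :=
  IsProbabilityMeasure T ∧ (∀ᵐ ν ∂T, IsPointMeasure ν ∧ ν ≤ μ) ∧
    ∀ f : X → ℝ, MemU f →
      laplaceT T f =
        expNeg (∫⁻ x, ENNReal.ofReal (-Real.log (1 - q + q * Real.exp (-f x))) ∂μ)

/-- `P` is the Poisson point process `Π_ϱ` with intensity (first moment) measure `ϱ`:
the point process with Laplace transform `L_P(f) = exp(-ϱ(1 - e^{-f}))`, `f ∈ U`. -/
def IsPoissonPP (ϱ : Measure X) (P : Measure (Measure X)) : Prop :=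
  IsProbabilityMeasure P ∧ (∀ᵐ μ ∂P, IsPointMeasure μ) ∧
    ∀ f : X → ℝ, MemU f →
      laplaceT P f = expNeg (∫⁻ x, ENNReal.ofReal (1 - Real.exp (-f x)) ∂ϱ)

/-- A point process: a probability law on the point measures of `X`. -/
def IsPointProcess (P : Measure (Measure X)) : Prop :=
  IsProbabilityMeasure P ∧ ∀ᵐ μ ∂P, IsPointMeasure μ

/-- The first moment (intensity) measure `ν_P` of a point process `P`:
`ν_P(B) = ∫ μ(B) P(dμ)`. -/
def momentMeasure (P : Measure (Measure X)) : Measure X := P.bind id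

/-- `P` is of first order if its first moment measure is a Radon (locally finite) measure. -/
def IsFirstOrder (P : Measure (Measure X)) : Prop := IsLocallyFiniteMeasure (momentMeasure P)

end PoissonSplitting

namespace PoissonSplitting

section Aux

set_option linter.unusedSectionVars false

/-! ### Uniqueness of Laplace functionals -/

lemma expNeg_zero : expNeg 0 = 1 := by simp [expNeg]

lemma expNeg_add (a b : ℝ≥0∞) : expNeg (a + b) = expNeg a * expNeg b := by
  unfold expNeg
  by_cases ha : a = ∞
  · simp [ha]
  by_cases hb : b = ∞
  · simp [hb]
  rw [if_neg (by simp [ha, hb]), if_neg ha, if_neg hb, ENNReal.toReal_add ha hb, neg_add,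
    Real.exp_add, ENNReal.ofReal_mul (Real.exp_pos _).le]

lemma expNeg_le_one (a : ℝ≥0∞) : expNeg a ≤ 1 := by
  unfold expNeg
  split_ifs
  · simp
  · simp

lemma expNeg_of_ne_top {a : ℝ≥0∞} (h : a ≠ ∞) :
    expNeg a = ENNReal.ofReal (Real.exp (-a.toReal)) := by
  simp [expNeg, h]

lemma expNeg_toReal_of_ne_top {a : ℝ≥0∞} (h : a ≠ ∞) :
    (expNeg a).toReal = Real.exp (-a.toReal) := by
  rw [expNeg_of_ne_top h, ENNReal.toReal_ofReal (Real.exp_pos _).le]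

lemma expNeg_ne_top (a : ℝ≥0∞) : expNeg a ≠ ∞ := ((expNeg_le_one a).trans_lt (by simp)).ne

lemma expNeg_ofReal {a : ℝ} (h : 0 ≤ a) :
    expNeg (ENNReal.ofReal a) = ENNReal.ofReal (Real.exp (-a)) := by
  rw [expNeg_of_ne_top (by simp), ENNReal.toReal_ofReal h]

lemma measurable_expNeg : Measurable expNeg := by
  unfold expNeg
  refine Measurable.ite (measurableSet_singleton _) measurable_const ?_
  exact (Real.measurable_exp.comp ENNReal.measurable_toReal.neg).ennreal_ofReal

lemma continuous_expNeg : Continuous expNeg := by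
  rw [continuous_iff_continuousAt]
  intro a
  by_cases ha : a = ∞
  · subst ha
    rw [ContinuousAt]
    have h0 : expNeg ∞ = 0 := by simp [expNeg]
    rw [h0, ENNReal.tendsto_nhds_zero]
    intro ε hε
    obtain ⟨δ, hδ0, hδ⟩ : ∃ δ : ℝ, 0 < δ ∧ ENNReal.ofReal δ ≤ ε := by
      by_cases h : ε = ∞
      · exact ⟨1, one_pos, by simp [h]⟩
      · exact ⟨ε.toReal, ENNReal.toReal_pos hε.ne' h, by simp [h]⟩
    have h1 : ∀ᶠ b in nhds (∞ : ℝ≥0∞), ENNReal.ofReal (-Real.log δ) < b :=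
      lt_mem_nhds (by simp)
    filter_upwards [h1] with b hb
    refine le_trans ?_ hδ
    unfold expNeg
    split_ifs with hbt
    · simp
    · apply ENNReal.ofReal_le_ofReal
      rw [← Real.le_log_iff_exp_le hδ0]
      have : -Real.log δ < b.toReal := by
        rcases lt_or_ge (-Real.log δ) 0 with h | h
        · exact h.trans_le ENNReal.toReal_nonneg
        · exact (ENNReal.ofReal_lt_iff_lt_toReal h hbt).1 hb
      linarith
  · have : ContinuousAt (fun b : ℝ≥0∞ => ENNReal.ofReal (Real.exp (-b.toReal))) a := by
      have := (ENNReal.continuousAt_toReal ha).neg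
      exact ENNReal.continuous_ofReal.continuousAt.comp
        (Real.continuous_exp.continuousAt.comp this)
    refine this.congr ?_
    filter_upwards [isOpen_ne.mem_nhds ha] with b hb
    exact (expNeg_of_ne_top hb).symm

/-- left inverse of `expNeg`. -/
def expNegInv (y : ℝ) : ℝ≥0∞ := if y = 0 then ∞ else ENNReal.ofReal (-Real.log y)

lemma measurable_expNegInv : Measurable expNegInv := by
  unfold expNegInv
  exact Measurable.ite (measurableSet_singleton _) measurable_const
    Real.measurable_log.neg.ennreal_ofReal

lemma expNegInv_expNeg (a : ℝ≥0∞) : expNegInv (expNeg a).toReal = a := by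
  by_cases ha : a = ∞
  · simp [expNeg, expNegInv, ha]
  · rw [expNeg_toReal_of_ne_top ha, expNegInv, if_neg (Real.exp_pos _).ne', Real.log_exp, neg_neg,
      ENNReal.ofReal_toReal ha]

variable {X : Type*} [MeasurableSpace X] [MetricSpace X]

lemma measurable_pairing {f : X → ℝ} (hf : Measurable f) : Measurable (pairing f) :=
  Measure.measurable_lintegral hf.ennreal_ofReal

lemma pairing_add {f g : X → ℝ} (hf : Measurable f) (hf0 : ∀ x, 0 ≤ f x) (hg0 : ∀ x, 0 ≤ g x)
    (ν : Measure X) : pairing (fun x => f x + g x) ν = pairing f ν + pairing g ν := by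
  unfold pairing
  simp_rw [fun x => ENNReal.ofReal_add (hf0 x) (hg0 x)]
  exact lintegral_add_left hf.ennreal_ofReal _

lemma MemU.add {f g : X → ℝ} (hf : MemU f) (hg : MemU g) : MemU (fun x => f x + g x) := by
  obtain ⟨h1, h2, ⟨C, h3⟩, h4⟩ := hf
  obtain ⟨h1', h2', ⟨C', h3'⟩, h4'⟩ := hg
  refine ⟨h1.add h1', fun x => add_nonneg (h2 x) (h2' x), ⟨C + C', fun x => add_le_add (h3 x) (h3' x)⟩,
    (h4.union h4').subset (Function.support_add f g)⟩

lemma laplaceT_le_one (R : Measure (Measure X)) [IsProbabilityMeasure R] (f : X → ℝ) :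
    laplaceT R f ≤ 1 := by
  calc laplaceT R f ≤ ∫⁻ _, 1 ∂(R) := lintegral_mono fun _ => expNeg_le_one _
    _ = 1 := by simp

lemma measurable_expNeg_pairing {f : X → ℝ} (hf : Measurable f) :
    Measurable (fun ν : Measure X => expNeg (pairing f ν)) :=
  measurable_expNeg.comp (measurable_pairing hf)

lemma integral_expNeg_pairing (R : Measure (Measure X)) {f : X → ℝ} (hf : Measurable f) :
    ∫ ν, (expNeg (pairing f ν)).toReal ∂(R) = (laplaceT R f).toReal :=
  integral_toReal (measurable_expNeg_pairing hf).aemeasurable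
    (Filter.Eventually.of_forall fun _ => (expNeg_ne_top _).lt_top)

/-- coordinate map -/
def coordMap (B : ℕ → Set X) (ν : Measure X) :
    ({A : Set X // MeasurableSet A} × ℕ) → unitInterval :=
  fun i => ⟨(expNeg (ν (i.1.1 ∩ B i.2))).toReal, ENNReal.toReal_nonneg,
    ENNReal.toReal_le_of_le_ofReal zero_le_one (by simpa using expNeg_le_one _)⟩

lemma measurable_coordMap {B : ℕ → Set X} (hBm : ∀ n, MeasurableSet (B n)) :
    Measurable (coordMap B) := by
  rw [measurable_pi_iff]
  intro i
  refine Measurable.subtype_mk ?_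
  exact (measurable_expNeg.comp (Measure.measurable_coe (i.1.2.inter (hBm _)))).ennreal_toReal

open BoundedContinuousFunction in
theorem ext_of_laplace (R R' : Measure (Measure X)) [IsProbabilityMeasure R]
    [IsProbabilityMeasure R'] (B : ℕ → Set X) (hBm : ∀ n, MeasurableSet (B n))
    (hBmono : Monotone B) (hBU : ⋃ n, B n = Set.univ)
    (hBb : ∀ n, Bornology.IsBounded (B n))
    (h : ∀ f : X → ℝ, MemU f → (∃ n, Function.support f ⊆ B n) → laplaceT R f = laplaceT R' f) :
    R = R' := by
  have hΦ := measurable_coordMap hBm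
  have key : R.map (coordMap B) = R'.map (coordMap B) := by
    have : IsProbabilityMeasure (R.map (coordMap B)) :=
      Measure.isProbabilityMeasure_map hΦ.aemeasurable
    have : IsProbabilityMeasure (R'.map (coordMap B)) :=
      Measure.isProbabilityMeasure_map hΦ.aemeasurable
    have hfin : ∀ I : Finset ({A : Set X // MeasurableSet A} × ℕ),
        (R.map (coordMap B)).map I.restrict = (R'.map (coordMap B)).map I.restrict := by
      intro I
      have hr : Measurable (I.restrict (π := fun _ => unitInterval)) := I.measurable_restrict
      have : IsProbabilityMeasure ((R.map (coordMap B)).map I.restrict) :=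
        Measure.isProbabilityMeasure_map hr.aemeasurable
      have : IsProbabilityMeasure ((R'.map (coordMap B)).map I.restrict) :=
        Measure.isProbabilityMeasure_map hr.aemeasurable
      let co : I → ((I → unitInterval) →ᵇ ℝ) := fun i =>
        BoundedContinuousFunction.mkOfCompact ⟨fun y => (y i : ℝ), by fun_prop⟩
      let A : StarSubalgebra ℝ ((I → unitInterval) →ᵇ ℝ) :=
        { Algebra.adjoin ℝ (Set.range co) with
          star_mem' := fun {a} ha => by
            have : star a = a := by ext; simp
            rw [this]; exact ha }
      refine ext_of_forall_mem_subalgebra_integral_eq_of_polish (𝕜 := ℝ) (A := A) ?_ ?_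
      · intro x y hxy
        obtain ⟨i, hi⟩ := Function.ne_iff.1 hxy
        refine ⟨co i, ⟨_, ⟨co i, ?_, rfl⟩, rfl⟩, ?_⟩
        · exact Algebra.subset_adjoin ⟨i, rfl⟩
        · simpa [co, Subtype.ext_iff] using hi
      · intro g hg
        have hIntMap : ∀ (g : (I → unitInterval) →ᵇ ℝ) (ρ : Measure (Measure X)),
            ∫ x, g x ∂((ρ.map (coordMap B)).map I.restrict) =
              ∫ ν, g (I.restrict (coordMap B ν)) ∂ρ := by
          intro g ρ
          rw [integral_map hr.aemeasurable g.continuous.aestronglyMeasurable,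
            integral_map (f := fun y => g (I.restrict y)) hΦ.aemeasurable
              (g.continuous.measurable.comp hr).aestronglyMeasurable]
        have hmono : ∀ g ∈ Submonoid.closure (Set.range co), ∃ f : X → ℝ, MemU f ∧
            (∃ n, Function.support f ⊆ B n) ∧
            ∀ ν, g (I.restrict (coordMap B ν)) = (expNeg (pairing f ν)).toReal := by
          intro g hg
          induction hg using Submonoid.closure_induction with
          | mem g hg =>
            obtain ⟨i, rfl⟩ := hg
            refine ⟨(i.1.1.1 ∩ B i.1.2).indicator 1, ⟨?_, ?_, ⟨1, ?_⟩, ?_⟩, ⟨i.1.2, ?_⟩, ?_⟩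
            · exact measurable_one.indicator (i.1.1.2.inter (hBm _))
            · intro x; exact Set.indicator_nonneg (by simp) x
            · intro x; exact Set.indicator_le_self' (by simp) x
            · exact (hBb i.1.2).subset (Set.support_indicator_subset.trans Set.inter_subset_right)
            · exact Set.support_indicator_subset.trans Set.inter_subset_right
            · intro ν
              have : pairing ((i.1.1.1 ∩ B i.1.2).indicator 1) ν = ν (i.1.1.1 ∩ B i.1.2) := by
                rw [pairing, ← lintegral_indicator_one (i.1.1.2.inter (hBm _))]
                congr 1; ext x
                by_cases hx : x ∈ i.1.1.1 ∩ B i.1.2 <;> simp [hx]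
              rw [this]; rfl
          | one =>
            refine ⟨0, ⟨measurable_zero, by simp, ⟨0, by simp⟩, by simp⟩, ⟨0, by simp⟩, ?_⟩
            intro ν; simp [pairing, expNeg_zero]
          | mul g g' _ _ ih ih' =>
            obtain ⟨f, hf, ⟨n, hn⟩, hfν⟩ := ih
            obtain ⟨f', hf', ⟨n', hn'⟩, hfν'⟩ := ih'
            refine ⟨fun x => f x + f' x, hf.add hf', ⟨max n n', ?_⟩, ?_⟩
            · refine (Function.support_add f f').trans (Set.union_subset ?_ ?_)
              · exact hn.trans (hBmono (le_max_left _ _))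
              · exact hn'.trans (hBmono (le_max_right _ _))
            · intro ν
              rw [pairing_add hf.1 hf.2.1 hf'.2.1, expNeg_add, ENNReal.toReal_mul, ← hfν, ← hfν']
              rfl
        have hg' : g ∈ Submodule.span ℝ (Submonoid.closure (Set.range co) :
            Set ((I → unitInterval) →ᵇ ℝ)) := by
          rw [← Algebra.adjoin_eq_span]; exact hg
        clear hg
        induction hg' using Submodule.span_induction with
        | mem g hg =>
          obtain ⟨f, hf, hn, hfν⟩ := hmono g hg
          rw [hIntMap, hIntMap]
          simp_rw [hfν]
          rw [integral_expNeg_pairing _ hf.1, integral_expNeg_pairing _ hf.1, h f hf hn]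
        | zero => simp
        | add g g' h1 h2 ih ih' =>
          simp only [BoundedContinuousFunction.coe_add, Pi.add_apply]
          rw [integral_add (g.integrable _) (g'.integrable _),
            integral_add (g.integrable _) (g'.integrable _), ih, ih']
        | smul a g h1 ih =>
          simp only [BoundedContinuousFunction.coe_smul]
          rw [integral_smul, integral_smul, ih]
    exact IsProjectiveLimit.unique (P := fun I => (R'.map (coordMap B)).map I.restrict)
      hfin (fun I => rfl)
  have hle : (Measure.instMeasurableSpace : MeasurableSpace (Measure X)) ≤
      MeasurableSpace.comap (coordMap B) inferInstance := by
    refine iSup₂_le fun A hA => ?_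
    have hm : Measurable[MeasurableSpace.comap (coordMap B) inferInstance]
        (fun ν : Measure X => ν A) := by
      have : (fun ν : Measure X => ν A) =
          (fun y => ⨆ n, expNegInv (y (⟨A, hA⟩, n) : ℝ)) ∘ coordMap B := by
        ext ν
        simp only [Function.comp, coordMap, expNegInv_expNeg]
        rw [← Monotone.measure_iUnion, ← Set.inter_iUnion, hBU, Set.inter_univ]
        intro n m hnm
        exact Set.inter_subset_inter_right _ (hBmono hnm)
      rw [this]
      refine Measurable.comp ?_ (comap_measurable _)
      exact Measurable.iSup fun n => measurable_expNegInv.comp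
        (measurable_subtype_coe.comp (measurable_pi_apply _))
    rw [← BorelSpace.measurable_eq (α := ℝ≥0∞)]
    exact hm.comap_le
  ext s hs
  obtain ⟨E, hE, rfl⟩ := hle s hs
  rw [← Measure.map_apply hΦ hE, ← Measure.map_apply hΦ hE, key]

end Aux
end PoissonSplitting

namespace PoissonSplitting

section Analysis

lemma linear_of_functional (l : ℝ → ℝ) (c q : ℝ) (hq : q ∈ Set.Ioo (0 : ℝ) 1)
    (hcont : ContinuousOn l (Set.Ico 0 1)) (h0 : l 0 = 0)
    (hd : HasDerivWithinAt l c (Set.Ici 0) 0)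
    (hf : ∀ x y, 0 ≤ y → y ≤ x → x < 1 →
      l (q * x + (1 - q) * y) + l (q * y) = l (q * x) + l y) :
    ∀ t, 0 ≤ t → t < 1 → l t = c * t := by
  obtain ⟨hq0, hq1⟩ := hq
  have h1q : 0 < 1 - q := by linarith
  -- right derivative
  have hder : ∀ t, 0 ≤ t → t < q → HasDerivWithinAt l c (Set.Ici t) t := by
    intro t ht0 htq
    rcases ht0.eq_or_lt with rfl | ht
    · exact hd
    have e1 : HasDerivWithinAt (fun s => l ((s - t) / (1 - q))) (c * (1 / (1 - q)))
        (Set.Ici t) t := by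
      have hi : HasDerivWithinAt (fun s : ℝ => (s - t) / (1 - q)) (1 / (1 - q)) (Set.Ici t) t :=
        (((hasDerivAt_id t).sub_const t).div_const (1 - q)).hasDerivWithinAt
      refine HasDerivWithinAt.comp (h₂ := l) (h := fun s : ℝ => (s - t) / (1 - q)) t
        (s' := Set.Ici 0) (by simpa using hd) hi ?_
      intro s hs
      exact div_nonneg (by simpa using hs) h1q.le
    have e2 : HasDerivWithinAt (fun s => l (q * ((s - t) / (1 - q)))) (c * (q * (1 / (1 - q))))
        (Set.Ici t) t := by
      have hi : HasDerivWithinAt (fun s : ℝ => q * ((s - t) / (1 - q))) (q * (1 / (1 - q)))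
          (Set.Ici t) t :=
        ((((hasDerivAt_id t).sub_const t).div_const (1 - q)).const_mul q).hasDerivWithinAt
      refine HasDerivWithinAt.comp (h₂ := l) (h := fun s : ℝ => q * ((s - t) / (1 - q))) t
        (s' := Set.Ici 0) (by simpa using hd) hi ?_
      intro s hs
      exact mul_nonneg hq0.le (div_nonneg (by simpa using hs) h1q.le)
    have e3 : HasDerivWithinAt (fun s => l t + l ((s - t) / (1 - q)) - l (q * ((s - t) / (1 - q))))
        c (Set.Ici t) t := by
      have := (e1.const_add (l t)).sub e2
      have hc : c * (1 / (1 - q)) - c * (q * (1 / (1 - q))) = c := by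
        field_simp
      rw [hc] at this
      exact this
    refine e3.congr_of_eventuallyEq_of_mem ?_ (by simp)
    have hev : ∀ᶠ s in nhdsWithin t (Set.Ici t), s < t + (1 - q) * (t / q) :=
      mem_nhdsWithin_of_mem_nhds (Iio_mem_nhds (by have := mul_pos h1q (div_pos ht hq0); linarith))
    filter_upwards [hev, self_mem_nhdsWithin] with s hs hs'
    have hs' : t ≤ s := hs'
    have := hf (t / q) ((s - t) / (1 - q)) (div_nonneg (by linarith) h1q.le)
      (by rw [div_le_iff₀ h1q]; linarith) (by rw [div_lt_one hq0]; exact htq)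
    rw [mul_div_cancel₀ _ hq0.ne', mul_div_cancel₀ _ h1q.ne'] at this
    rw [add_sub_cancel] at this
    linarith
  have base : ∀ t, 0 ≤ t → t < q → l t = c * t := by
    intro t ht0 htq
    have := constant_of_has_deriv_right_zero (f := fun s => l s - c * s) (a := 0) (b := t) ?_ ?_ t
      ⟨ht0, le_rfl⟩
    · simp [h0] at this; linarith
    · refine ContinuousOn.sub (hcont.mono ?_) (by fun_prop)
      intro s hs; exact ⟨hs.1, by linarith [hs.2]⟩
    · intro s hs
      have h1 : HasDerivWithinAt (fun s => c * s) c (Set.Ici s) s := by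
        simpa using ((hasDerivAt_id s).const_mul c).hasDerivWithinAt
      have h2 := (hder s hs.1 (by linarith [hs.2])).sub h1
      rw [sub_self] at h2
      exact h2
  have step : ∀ n : ℕ, ∀ s, 0 ≤ s → s < 1 →
      l (s * (1 - (1 - q) ^ n)) = c * (s * (1 - (1 - q) ^ n)) := by
    intro n
    induction n with
    | zero => intro s _ _; simp [h0]
    | succ n ih =>
      intro s hs0 hs1
      have hp1 : (1 - q) ^ n ≤ 1 := pow_le_one₀ h1q.le (by linarith)
      have hp0 : 0 < (1 - q) ^ n := pow_pos h1q n
      have := hf s (s * (1 - (1 - q) ^ n)) (mul_nonneg hs0 (by linarith))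
        (by nlinarith) hs1
      have e : q * s + (1 - q) * (s * (1 - (1 - q) ^ n)) = s * (1 - (1 - q) ^ (n + 1)) := by ring
      have e2 : q * (s * (1 - (1 - q) ^ n)) = (q * s) * (1 - (1 - q) ^ n) := by ring
      rw [e, e2, ih s hs0 hs1, ih (q * s) (by positivity) (by nlinarith),
        base (q * s) (by positivity) (by nlinarith)] at this
      rw [pow_succ] at *
      linarith
  intro t ht0 ht1
  obtain ⟨n, hn⟩ := exists_pow_lt_of_lt_one (sub_pos.2 ht1) (show 1 - q < 1 by linarith)
  have hpos : 0 < 1 - (1 - q) ^ n := by linarith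
  have := step n (t / (1 - (1 - q) ^ n)) (div_nonneg ht0 hpos.le)
    (by rw [div_lt_one hpos]; linarith)
  rwa [div_mul_cancel₀ _ hpos.ne'] at this

/-- Right derivative at `0` of a Laplace transform. -/
lemma tendsto_laplace_slope {Ω : Type*} [MeasurableSpace Ω] (P : Measure Ω)
    [IsProbabilityMeasure P] (m : Ω → ℝ) (hm : Integrable m P) (hm0 : ∀ ω, 0 ≤ m ω) :
    Filter.Tendsto (fun t : ℝ => ((∫ ω, Real.exp (-(t * m ω)) ∂P) - 1) / t)
      (nhdsWithin 0 (Set.Ioi 0)) (nhds (-∫ ω, m ω ∂P)) := by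
  have h : Filter.Tendsto (fun t : ℝ => ∫ ω, (Real.exp (-(t * m ω)) - 1) / t ∂P)
      (nhdsWithin 0 (Set.Ioi 0)) (nhds (∫ ω, -m ω ∂P)) := by
    refine tendsto_integral_filter_of_dominated_convergence m ?_ ?_ hm ?_
    · refine Filter.Eventually.of_forall fun t => ?_
      exact ((Real.continuous_exp.comp_aestronglyMeasurable
        (hm.aestronglyMeasurable.const_mul t).neg).sub aestronglyMeasurable_const).mul_const _
    · filter_upwards [self_mem_nhdsWithin] with t ht
      have ht : 0 < t := ht
      refine Filter.Eventually.of_forall fun ω => ?_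
      have h1 := Real.add_one_le_exp (-(t * m ω))
      have h2 : Real.exp (-(t * m ω)) ≤ 1 :=
        Real.exp_le_one_iff.2 (by have := mul_nonneg ht.le (hm0 ω); linarith)
      rw [Real.norm_eq_abs, abs_div, abs_of_pos ht, div_le_iff₀ ht, abs_of_nonpos (by linarith)]
      linarith
    · refine Filter.Eventually.of_forall fun ω => ?_
      have hd : HasDerivAt (fun t : ℝ => Real.exp (-(t * m ω))) (-m ω) 0 := by
        have := (((hasDerivAt_id (0 : ℝ)).mul_const (m ω)).neg).exp
        simpa using this
      have := (hasDerivAt_iff_tendsto_slope.1 hd).mono_left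
        (nhdsWithin_mono 0 (s := Set.Ioi 0) (fun x hx => (ne_of_gt hx)))
      refine this.congr fun t => ?_
      simp [slope_def_field]
  rw [integral_neg] at h
  refine h.congr' ?_
  filter_upwards [self_mem_nhdsWithin] with t ht
  have ht : 0 < t := ht
  rw [integral_div, integral_sub _ (integrable_const _)]
  · simp
  · refine Integrable.of_bound (Real.continuous_exp.comp_aestronglyMeasurable
      (hm.aestronglyMeasurable.const_mul t).neg) 1 (Filter.Eventually.of_forall fun ω => ?_)
    rw [Real.norm_eq_abs, abs_of_pos (Real.exp_pos _)]
    exact Real.exp_le_one_iff.2 (by have := mul_nonneg ht.le (hm0 ω); simpa using this)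

end Analysis
end PoissonSplitting

namespace PoissonSplitting

section Core

set_option linter.unusedSectionVars false

variable {X : Type*} [MeasurableSpace X] [MetricSpace X]

/-- the function `-log (1 - t w)` -/
def nlog (t : ℝ) (w : X → ℝ) : X → ℝ := fun x => -Real.log (1 - t * w x)

lemma measurable_nlog (t : ℝ) {w : X → ℝ} (hw : Measurable w) : Measurable (nlog t w) :=
  (Real.measurable_log.comp (measurable_const.sub (hw.const_mul t))).neg

lemma exp_neg_nlog {t : ℝ} {w : X → ℝ} {x : X} (ht0 : 0 ≤ t) (ht1 : t < 1)
    (hw1 : w x ≤ 1) : Real.exp (-nlog t w x) = 1 - t * w x := by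
  rw [nlog, neg_neg, Real.exp_log]
  nlinarith

lemma nlog_ge {t : ℝ} {w : X → ℝ} {x : X} (ht0 : 0 ≤ t) (ht1 : t < 1)
    (hw1 : w x ≤ 1) : t * w x ≤ nlog t w x := by
  have h : 0 < 1 - t * w x := by nlinarith
  have := Real.log_le_sub_one_of_pos h
  rw [nlog]; linarith

lemma nlog_mono {s t : ℝ} {w : X → ℝ} {x : X} (hs0 : 0 ≤ s) (hst : s ≤ t) (ht1 : t < 1)
    (hw0 : 0 ≤ w x) (hw1 : w x ≤ 1) : nlog s w x ≤ nlog t w x := by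
  have h : 0 < 1 - t * w x := by nlinarith
  rw [nlog, nlog, neg_le_neg_iff]
  exact Real.log_le_log h (by nlinarith)

lemma nlog_lip {s t a : ℝ} {w : X → ℝ} {x : X} (hs0 : 0 ≤ s) (hst : s ≤ t) (hta : t ≤ a)
    (ha1 : a < 1) (hw0 : 0 ≤ w x) (hw1 : w x ≤ 1) :
    nlog t w x ≤ nlog s w x + (t - s) / (1 - a) * w x := by
  have ht : 0 < 1 - t * w x := by nlinarith
  have hs : 0 < 1 - s * w x := by nlinarith
  have h1 := Real.log_le_sub_one_of_pos (div_pos hs ht)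
  rw [Real.log_div hs.ne' ht.ne'] at h1
  have h2 : (1 - s * w x) / (1 - t * w x) - 1 = (t - s) * w x / (1 - t * w x) := by
    rw [div_sub_one ht.ne']; congr 1; ring
  have h3 : (t - s) * w x / (1 - t * w x) ≤ (t - s) * w x / (1 - a) := by
    apply div_le_div_of_nonneg_left
    · exact mul_nonneg (by linarith) hw0
    · linarith
    · nlinarith
  have h4 : (t - s) / (1 - a) * w x = (t - s) * w x / (1 - a) := by ring
  rw [nlog, nlog, h4]; linarith

lemma nlog_zero (w : X → ℝ) : nlog 0 w = 0 := by ext; simp [nlog]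

lemma memU_nlog {t : ℝ} {w : X → ℝ} (ht0 : 0 ≤ t) (ht1 : t < 1) (hw : Measurable w)
    (hw0 : ∀ x, 0 ≤ w x) (hw1 : ∀ x, w x ≤ 1) (hb : Bornology.IsBounded (Function.support w)) :
    MemU (nlog t w) ∧ Function.support (nlog t w) ⊆ Function.support w := by
  have hsup : Function.support (nlog t w) ⊆ Function.support w := by
    intro x hx hx'
    exact hx (by simp [nlog, hx'])
  refine ⟨⟨measurable_nlog t hw, fun x => ?_, ⟨-Real.log (1 - t), fun x => ?_⟩, hb.subset hsup⟩,
    hsup⟩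
  · exact (mul_nonneg ht0 (hw0 x)).trans (nlog_ge ht0 ht1 (hw1 x))
  · rw [nlog, neg_le_neg_iff]
    exact Real.log_le_log (by linarith) (by nlinarith [hw1 x])

lemma lintegral_pairing (P : Measure (Measure X)) {w : X → ℝ} (hw : Measurable w) :
    ∫⁻ μ, pairing w μ ∂P = pairing w (momentMeasure P) := by
  rw [momentMeasure, pairing, Measure.lintegral_bind measurable_id.aemeasurable
    hw.ennreal_ofReal.aemeasurable]
  rfl

lemma pairing_mono {f g : X → ℝ} (h : ∀ x, f x ≤ g x) (μ : Measure X) :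
    pairing f μ ≤ pairing g μ :=
  lintegral_mono fun x => ENNReal.ofReal_le_ofReal (h x)

lemma pairing_smul {c : ℝ} (hc : 0 ≤ c) {w : X → ℝ} (hw : Measurable w) (μ : Measure X) :
    pairing (fun x => c * w x) μ = ENNReal.ofReal c * pairing w μ := by
  unfold pairing
  simp_rw [ENNReal.ofReal_mul hc]
  exact lintegral_const_mul _ hw.ennreal_ofReal

theorem core (P : Measure (Measure X)) [IsProbabilityMeasure P] (w : X → ℝ) (hw : Measurable w)
    (hw0 : ∀ x, 0 ≤ w x) (hw1 : ∀ x, w x ≤ 1) (hfin : pairing w (momentMeasure P) ≠ ∞)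
    (q : ℝ) (hq : q ∈ Set.Ioo (0 : ℝ) 1)
    (hfun : ∀ x y, 0 ≤ y → y ≤ x → x < 1 →
      laplaceT P (nlog (q * x + (1 - q) * y) w) * laplaceT P (nlog (q * y) w) =
      laplaceT P (nlog (q * x) w) * laplaceT P (nlog y w)) (t : ℝ) (ht0 : 0 ≤ t) (ht1 : t < 1) :
    laplaceT P (nlog t w) =
      ENNReal.ofReal (Real.exp (-(t * (pairing w (momentMeasure P)).toReal))) := by
  obtain ⟨hq0, hq1⟩ := hq
  set M := (pairing w (momentMeasure P)).toReal with hM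
  have hae : ∀ᵐ μ ∂P, pairing w μ < ∞ :=
    ae_lt_top (measurable_pairing hw) (by rwa [lintegral_pairing P hw])
  let m : Measure X → ℝ := fun μ => (pairing w μ).toReal
  have hmint : Integrable m P :=
    integrable_toReal_of_lintegral_ne_top (measurable_pairing hw).aemeasurable
      (by rwa [lintegral_pairing P hw])
  have hmM : ∫ μ, m μ ∂P = M := by
    rw [hM, ← lintegral_pairing P hw, integral_toReal (measurable_pairing hw).aemeasurable hae]
  let F : ℝ → Measure X → ℝ := fun t μ => (pairing (nlog t w) μ).toReal
  let k : ℝ → ℝ := fun t => (laplaceT P (nlog t w)).toReal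
  -- pairing bounds
  have hlip : ∀ s t a, 0 ≤ s → s ≤ t → t ≤ a → a < 1 → ∀ μ,
      pairing (nlog t w) μ ≤ pairing (nlog s w) μ + ENNReal.ofReal ((t - s) / (1 - a)) * pairing w μ := by
    intro s t a hs hst hta ha μ
    have hc : 0 ≤ (t - s) / (1 - a) := div_nonneg (by linarith) (by linarith)
    rw [← pairing_smul hc hw, ← pairing_add (measurable_nlog s hw)]
    · exact pairing_mono (fun x => nlog_lip hs hst hta ha (hw0 x) (hw1 x)) μ
    · exact fun x => (mul_nonneg hs (hw0 x)).trans (nlog_ge hs (by linarith) (hw1 x))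
    · exact fun x => mul_nonneg hc (hw0 x)
  have hp0 : ∀ μ, pairing (nlog 0 w) μ = 0 := by
    intro μ; rw [nlog_zero]; simp [pairing]
  have hft : ∀ t, 0 ≤ t → t < 1 → ∀ μ, pairing w μ < ∞ → pairing (nlog t w) μ ≠ ∞ := by
    intro t h0 h1 μ hμ
    refine ((hlip 0 t t le_rfl h0 le_rfl h1 μ).trans_lt ?_).ne
    rw [hp0, zero_add]
    exact ENNReal.mul_lt_top (by simp) hμ
  have hFlip : ∀ s t a, 0 ≤ s → s ≤ t → t ≤ a → a < 1 → ∀ μ, pairing w μ < ∞ →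
      F t μ ≤ F s μ + (t - s) / (1 - a) * m μ := by
    intro s t a hs hst hta ha μ hμ
    have hc : 0 ≤ (t - s) / (1 - a) := div_nonneg (by linarith) (by linarith)
    have h1 := hft s hs (by linarith) μ hμ
    have h2 : ENNReal.ofReal ((t - s) / (1 - a)) * pairing w μ ≠ ∞ :=
      (ENNReal.mul_lt_top (by simp) hμ).ne
    have := ENNReal.toReal_mono (by simp [h1, h2]) (hlip s t a hs hst hta ha μ)
    rwa [ENNReal.toReal_add h1 h2, ENNReal.toReal_mul, ENNReal.toReal_ofReal hc] at this
  have hFmono : ∀ s t, 0 ≤ s → s ≤ t → t < 1 → ∀ μ, pairing w μ < ∞ → F s μ ≤ F t μ := by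
    intro s t hs hst ht μ hμ
    exact ENNReal.toReal_mono (hft t (by linarith) ht μ hμ)
      (pairing_mono (fun x => nlog_mono hs hst ht (hw0 x) (hw1 x)) μ)
  have hFge : ∀ t, 0 ≤ t → t < 1 → ∀ μ, pairing w μ < ∞ → t * m μ ≤ F t μ := by
    intro t h0 h1 μ hμ
    have := ENNReal.toReal_mono (hft t h0 h1 μ hμ)
      (pairing_mono (fun x => nlog_ge h0 h1 (hw1 x)) μ)
    rwa [pairing_smul h0 hw, ENNReal.toReal_mul, ENNReal.toReal_ofReal h0] at this
  have hF0 : ∀ μ, F 0 μ = 0 := by intro μ; simp [F, hp0]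
  have hFm : ∀ t, Measurable (F t) := fun t =>
    (measurable_pairing (measurable_nlog t hw)).ennreal_toReal
  have hexpint : ∀ G : Measure X → ℝ, AEStronglyMeasurable G P → (∀ᵐ μ ∂P, 0 ≤ G μ) →
      Integrable (fun μ => Real.exp (-G μ)) P := by
    intro G hG hG0
    refine Integrable.of_bound (Real.continuous_exp.comp_aestronglyMeasurable hG.neg) 1 ?_
    filter_upwards [hG0] with μ hμ
    rw [Real.norm_eq_abs, abs_of_pos (Real.exp_pos _)]
    exact Real.exp_le_one_iff.2 (by simpa using hμ)
  have hFint : ∀ t, Integrable (fun μ => Real.exp (-F t μ)) P := fun t =>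
    hexpint _ (hFm t).aestronglyMeasurable
      (Filter.Eventually.of_forall fun _ => ENNReal.toReal_nonneg)
  have hk : ∀ t, 0 ≤ t → t < 1 → k t = ∫ μ, Real.exp (-F t μ) ∂P := by
    intro t h0 h1
    change (laplaceT P (nlog t w)).toReal = _
    rw [← integral_expNeg_pairing P (measurable_nlog t hw)]
    refine integral_congr_ae ?_
    filter_upwards [hae] with μ hμ
    exact expNeg_toReal_of_ne_top (hft t h0 h1 μ hμ)
  have hkpos : ∀ t, 0 ≤ t → t < 1 → 0 < k t := by
    intro t h0 h1
    rw [hk t h0 h1]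
    exact integral_exp_pos (hFint t)
  have hk0 : k 0 = 1 := by
    rw [hk 0 le_rfl one_pos]; simp [hF0]
  -- Lipschitz
  have hklip : ∀ a, a < 1 → ∀ s t, 0 ≤ s → s ≤ t → t ≤ a →
      |k s - k t| ≤ M / (1 - a) * |s - t| := by
    intro a ha s t hs hst hta
    rw [hk s hs (by linarith), hk t (by linarith) (by linarith),
      ← integral_sub (hFint s) (hFint t)]
    have e : M / (1 - a) * |s - t| = ∫ μ, (t - s) / (1 - a) * m μ ∂P := by
      rw [integral_const_mul, hmM, abs_of_nonpos (by linarith)]; ring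
    rw [e, abs_of_nonneg]
    · refine integral_mono_ae ((hFint s).sub (hFint t)) (hmint.const_mul _) ?_
      filter_upwards [hae] with μ hμ
      have h1 := hFlip s t a hs hst hta ha μ hμ
      have h2 := hFmono s t hs hst (by linarith) μ hμ
      have h3 : Real.exp (-F t μ) = Real.exp (-F s μ) * Real.exp (-(F t μ - F s μ)) := by
        rw [← Real.exp_add]; ring_nf
      have h4 := Real.add_one_le_exp (-(F t μ - F s μ))
      have h5 : Real.exp (-F s μ) ≤ 1 :=
        Real.exp_le_one_iff.2 (by have : 0 ≤ F s μ := ENNReal.toReal_nonneg; linarith)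
      have h6 := Real.exp_pos (-F s μ)
      change Real.exp (-F s μ) - Real.exp (-F t μ) ≤ _
      rw [h3]
      nlinarith
    · refine integral_nonneg_of_ae ?_
      filter_upwards [hae] with μ hμ
      have h2 := hFmono s t hs hst (by linarith) μ hμ
      have := Real.exp_le_exp.2 (neg_le_neg h2)
      simpa using this
  have hkcont : ContinuousOn k (Set.Ico 0 1) := by
    intro t ht
    obtain ⟨a, hta, ha1⟩ := exists_between ht.2
    have hM0 : 0 ≤ M / (1 - a) := div_nonneg ENNReal.toReal_nonneg (by linarith)
    have hL : LipschitzOnWith ⟨M / (1 - a), hM0⟩ k (Set.Icc 0 a) := by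
      refine LipschitzOnWith.of_dist_le_mul fun x hx y hy => ?_
      rw [Real.dist_eq, Real.dist_eq]
      rcases le_total x y with h | h
      · exact hklip a ha1 x y hx.1 h hy.2
      · rw [abs_sub_comm, abs_sub_comm x y]
        exact hklip a ha1 y x hy.1 h hx.2
    refine (hL.continuousOn t ⟨ht.1, hta.le⟩).mono_of_mem_nhdsWithin ?_
    rw [mem_nhdsWithin]
    exact ⟨Set.Iio a, isOpen_Iio, hta, fun x hx => ⟨hx.2.1, le_of_lt hx.1⟩⟩
  -- derivative at zero
  have hslope := tendsto_laplace_slope P m hmint (fun _ => ENNReal.toReal_nonneg)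
  rw [hmM] at hslope
  have hkder : HasDerivWithinAt k (-M) (Set.Ici 0) 0 := by
    rw [hasDerivWithinAt_iff_tendsto_slope]
    have hset : Set.Ici (0 : ℝ) \ {0} = Set.Ioi 0 := by
      ext x; simp [lt_iff_le_and_ne, eq_comm]
    rw [hset]
    have hsub : Filter.Tendsto (fun t : ℝ => t / (1 - t)) (nhdsWithin 0 (Set.Ioi 0))
        (nhdsWithin 0 (Set.Ioi 0)) := by
      rw [tendsto_nhdsWithin_iff]
      constructor
      · have : ContinuousAt (fun t : ℝ => t / (1 - t)) 0 := by
          apply ContinuousAt.div <;> first | fun_prop | norm_num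
        have h := this.tendsto
        simp only [zero_div] at h
        exact h.mono_left nhdsWithin_le_nhds
      · filter_upwards [self_mem_nhdsWithin,
          mem_nhdsWithin_of_mem_nhds (Iio_mem_nhds (zero_lt_one' ℝ))] with t h1 h2
        have h1 : (0 : ℝ) < t := h1
        have h2 : t < 1 := h2
        exact div_pos h1 (by linarith)
    have hlow := hslope.comp hsub
    have hone : Filter.Tendsto (fun t : ℝ => 1 / (1 - t)) (nhdsWithin 0 (Set.Ioi 0))
        (nhds 1) := by
      have : ContinuousAt (fun t : ℝ => 1 / (1 - t)) 0 := by
        apply ContinuousAt.div <;> first | fun_prop | norm_num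
      have h := this.tendsto
      simp only [sub_zero, div_one] at h
      exact h.mono_left nhdsWithin_le_nhds
    have hlow2 := hlow.mul hone
    rw [mul_one] at hlow2
    refine tendsto_of_tendsto_of_tendsto_of_le_of_le' hlow2 hslope ?_ ?_
    · filter_upwards [self_mem_nhdsWithin,
          mem_nhdsWithin_of_mem_nhds (Iio_mem_nhds (zero_lt_one' ℝ))] with t h1 h2
      have h1 : 0 < t := h1
      have h2 : t < 1 := h2
      have h3 : 0 < 1 - t := by linarith
      rw [slope_def_field, hk0, sub_zero]
      have e : ((∫ μ, Real.exp (-(t / (1 - t) * m μ)) ∂P) - 1) / (t / (1 - t)) * (1 / (1 - t)) =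
        ((∫ μ, Real.exp (-(t / (1 - t) * m μ)) ∂P) - 1) / t := by
        field_simp
      simp only [Function.comp]
      rw [e]
      refine div_le_div_of_nonneg_right (sub_le_sub_right ?_ _) h1.le
      rw [hk t h1.le h2]
      refine integral_mono_ae (hexpint _ (hmint.aestronglyMeasurable.const_mul _)
        (Filter.Eventually.of_forall fun μ => mul_nonneg (div_pos h1 h3).le ENNReal.toReal_nonneg))
        (hFint t) ?_
      filter_upwards [hae] with μ hμ
      have := hFlip 0 t t le_rfl h1.le le_rfl h2 μ hμ
      rw [hF0, zero_add, sub_zero] at this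
      exact Real.exp_le_exp.2 (neg_le_neg this)
    · filter_upwards [self_mem_nhdsWithin,
          mem_nhdsWithin_of_mem_nhds (Iio_mem_nhds (zero_lt_one' ℝ))] with t h1 h2
      have h1 : 0 < t := h1
      have h2 : t < 1 := h2
      rw [slope_def_field, hk0, sub_zero]
      refine div_le_div_of_nonneg_right (sub_le_sub_right ?_ _) h1.le
      rw [hk t h1.le h2]
      refine integral_mono_ae (hFint t) (hexpint _ (hmint.aestronglyMeasurable.const_mul _)
        (Filter.Eventually.of_forall fun μ => mul_nonneg h1.le ENNReal.toReal_nonneg)) ?_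
      filter_upwards [hae] with μ hμ
      exact Real.exp_le_exp.2 (neg_le_neg (hFge t h1.le h2 μ hμ))
  have hlin := linear_of_functional (fun t => Real.log (k t)) (-M) q ⟨hq0, hq1⟩
    (hkcont.log fun t ht => (hkpos t ht.1 ht.2).ne') (by simp [hk0])
    (by simpa [hk0] using hkder.log (by simp [hk0])) ?_ t ht0 ht1
  · have : k t = Real.exp (-(t * M)) := by
      rw [← Real.exp_log (hkpos t ht0 ht1)]
      congr 1
      rw [hlin]; ring
    rw [← this, ENNReal.ofReal_toReal]
    exact ((laplaceT_le_one P _).trans_lt (by simp)).ne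
  · intro x y hy hyx hx
    have hqx : q * x < 1 := by nlinarith
    have hqy : q * y < 1 := by nlinarith
    have h1 : 0 ≤ q * x + (1 - q) * y := by nlinarith
    have h2 : q * x + (1 - q) * y < 1 := by nlinarith
    have h := congrArg ENNReal.toReal (hfun x y hy hyx hx)
    rw [ENNReal.toReal_mul, ENNReal.toReal_mul] at h
    change k _ * k _ = k _ * k _ at h
    rw [← Real.log_mul (hkpos _ h1 h2).ne' (hkpos _ (by nlinarith) hqy).ne', h,
      Real.log_mul (hkpos _ (by nlinarith) hqx).ne' (hkpos _ hy (by linarith)).ne']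

end Core
end PoissonSplitting

namespace PoissonSplitting

section Main

set_option linter.unusedSectionVars false

variable {X : Type*} [MeasurableSpace X] [MetricSpace X]

lemma exists_exhaustion [BorelSpace X] (ν : Measure X) [SigmaFinite ν] :
    ∃ B : ℕ → Set X, (∀ n, MeasurableSet (B n)) ∧ Monotone B ∧ ⋃ n, B n = Set.univ ∧
      (∀ n, Bornology.IsBounded (B n)) ∧ ∀ n, ν (B n) < ∞ := by
  rcases isEmpty_or_nonempty X with h | ⟨⟨x0⟩⟩
  · exact ⟨fun _ => ∅, by simp, monotone_const, Subsingleton.elim _ _, by simp, by simp⟩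
  · refine ⟨fun n => spanningSets ν n ∩ Metric.closedBall x0 n, fun n => ?_, ?_, ?_, fun n => ?_,
      fun n => ?_⟩
    · exact (measurableSet_spanningSets ν n).inter Metric.isClosed_closedBall.measurableSet
    · intro n m hnm
      exact Set.inter_subset_inter (monotone_spanningSets ν hnm)
        (Metric.closedBall_subset_closedBall (by exact_mod_cast hnm))
    · refine Set.eq_univ_of_forall fun x => ?_
      have hx : x ∈ ⋃ n, spanningSets ν n := by rw [iUnion_spanningSets]; trivial
      obtain ⟨n, hn⟩ := Set.mem_iUnion.1 hx
      obtain ⟨k, hk⟩ := exists_nat_ge (dist x x0)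
      refine Set.mem_iUnion.2 ⟨max n k, monotone_spanningSets ν (le_max_left _ _) hn, ?_⟩
      rw [Metric.mem_closedBall]
      exact hk.trans (by exact_mod_cast le_max_right _ _)
    · exact Metric.isBounded_closedBall.subset Set.inter_subset_right
    · exact (measure_mono Set.inter_subset_left).trans_lt (measure_spanningSets_lt_top ν n)

lemma tendsto_pairing_indicator {B : ℕ → Set X} (hBm : ∀ n, MeasurableSet (B n))
    (hBmono : Monotone B) (hBU : ⋃ n, B n = Set.univ) {f : X → ℝ} (hf : Measurable f)
    (hf0 : ∀ x, 0 ≤ f x) (ν : Measure X) :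
    Filter.Tendsto (fun n => pairing ((B n).indicator f) ν) Filter.atTop (nhds (pairing f ν)) := by
  refine lintegral_tendsto_of_tendsto_of_monotone
    (fun n => (hf.indicator (hBm n)).ennreal_ofReal.aemeasurable) ?_ ?_
  · refine Filter.Eventually.of_forall fun x n m hnm => ?_
    exact ENNReal.ofReal_le_ofReal
      (Set.indicator_le_indicator_of_subset (hBmono hnm) hf0 x)
  · refine Filter.Eventually.of_forall fun x => ?_
    refine tendsto_const_nhds.congr' ?_
    have hx : x ∈ ⋃ n, B n := by rw [hBU]; trivial
    obtain ⟨N, hN⟩ := Set.mem_iUnion.1 hx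
    filter_upwards [Filter.eventually_ge_atTop N] with n hn
    rw [Set.indicator_of_mem (hBmono hn hN)]

lemma laplace_of_trunc {B : ℕ → Set X} (hBm : ∀ n, MeasurableSet (B n))
    (hBmono : Monotone B) (hBU : ⋃ n, B n = Set.univ) (M : Measure (Measure X))
    [IsProbabilityMeasure M] (ρ : Measure X)
    (h : ∀ f : X → ℝ, MemU f → (∃ n, Function.support f ⊆ B n) →
      laplaceT M f = expNeg (pairing (fun x => 1 - Real.exp (-f x)) ρ))
    (f : X → ℝ) (hf : MemU f) :
    laplaceT M f = expNeg (pairing (fun x => 1 - Real.exp (-f x)) ρ) := by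
  have h1 : Filter.Tendsto (fun n => laplaceT M ((B n).indicator f)) Filter.atTop
      (nhds (laplaceT M f)) := by
    refine tendsto_lintegral_of_dominated_convergence (fun _ => 1)
      (fun n => measurable_expNeg_pairing (hf.1.indicator (hBm n)))
      (fun n => Filter.Eventually.of_forall fun _ => expNeg_le_one _) (by simp)
      (Filter.Eventually.of_forall fun ν => ?_)
    exact (continuous_expNeg.tendsto _).comp
      (tendsto_pairing_indicator hBm hBmono hBU hf.1 hf.2.1 ν)
  have h2 : Filter.Tendsto
      (fun n => expNeg (pairing ((B n).indicator (fun x => 1 - Real.exp (-f x))) ρ)) Filter.atTop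
      (nhds (expNeg (pairing (fun x => 1 - Real.exp (-f x)) ρ))) := by
    refine (continuous_expNeg.tendsto _).comp (tendsto_pairing_indicator hBm hBmono hBU ?_ ?_ ρ)
    · exact measurable_const.sub (Real.measurable_exp.comp hf.1.neg)
    · intro x
      have := Real.exp_le_one_iff.2 (neg_nonpos.2 (hf.2.1 x))
      linarith
  refine tendsto_nhds_unique h1 (h2.congr fun n => ?_)
  rw [h ((B n).indicator f)]
  · congr 2
    ext x
    by_cases hx : x ∈ B n <;> simp [hx]
  · obtain ⟨a1, a2, ⟨C, a3⟩, a4⟩ := hf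
    refine ⟨a1.indicator (hBm n), fun x => Set.indicator_nonneg (fun x _ => a2 x) x, ⟨C, fun x => ?_⟩,
      a4.subset ?_⟩
    · exact (Set.indicator_le_self' (fun x _ => a2 x) x).trans (a3 x)
    · rw [Set.support_indicator]; exact Set.inter_subset_right
  · exact ⟨n, Set.support_indicator_subset⟩

lemma laplace_bind {P : Measure (Measure X)} {q : ℝ} {T : Measure X → Measure (Measure X)}
    (hTm : Measurable T) (hP : ∀ᵐ μ ∂P, IsPointMeasure μ)
    (hT : ∀ μ, IsPointMeasure μ → IsThinning q μ (T μ)) (f : X → ℝ) (hf : MemU f) :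
    laplaceT (P.bind T) f = laplaceT P (fun x => -Real.log (1 - q + q * Real.exp (-f x))) := by
  rw [laplaceT, Measure.lintegral_bind hTm.aemeasurable
    (measurable_expNeg_pairing hf.1).aemeasurable]
  refine lintegral_congr_ae ?_
  filter_upwards [hP] with μ hμ
  exact (hT μ hμ).2.2 f hf

lemma pairing_sub {μ ν : Measure X} (hle : ν ≤ μ) {g : X → ℝ} (hg : Measurable g)
    (hfin : μ (Function.support g) ≠ ∞) :
    pairing g (μ - ν) + pairing g ν = pairing g μ := by
  set s := Function.support g
  have hs : MeasurableSet s := measurableSet_support hg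
  have hr : ∀ ρ : Measure X, pairing g ρ = pairing g (ρ.restrict s) := by
    intro ρ
    unfold pairing
    rw [← lintegral_indicator hs]
    refine lintegral_congr fun x => ?_
    by_cases hx : x ∈ s
    · rw [Set.indicator_of_mem hx]
    · rw [Set.indicator_of_notMem hx, Function.notMem_support.1 hx, ENNReal.ofReal_zero]
  rw [hr (μ - ν), hr ν, hr μ, Measure.restrict_sub_eq_restrict_sub_restrict hs]
  have : IsFiniteMeasure (ν.restrict s) :=
    ⟨by rw [Measure.restrict_apply_univ]; exact (hle s).trans_lt hfin.lt_top⟩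
  unfold pairing
  rw [← lintegral_add_measure, Measure.sub_add_cancel_of_le (Measure.restrict_mono_measure hle s)]

lemma laplace_split (P : Measure (Measure X)) (hP : ∀ᵐ μ ∂P, IsPointMeasure μ)
    (q : ℝ) (hq : q ∈ Set.Ioo (0 : ℝ) 1)
    (T : Measure X → Measure (Measure X)) (hT : ∀ μ, IsPointMeasure μ → IsThinning q μ (T μ))
    (S : Measure (Measure X × Measure X))
    (hS : ∀ h : Measure X × Measure X → ℝ≥0∞, Measurable h →
      ∫⁻ p, h p ∂S = ∫⁻ μ, ∫⁻ ν, h (ν, μ - ν) ∂(T μ) ∂P)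
    (Υ : ProbabilityTheory.Kernel (Measure X) (Measure X))
    (hdis : ∀ h : Measure X × Measure X → ℝ≥0∞, Measurable h →
      ∫⁻ p, h p ∂S = ∫⁻ ν, ∫⁻ η, h (ν, η) ∂(Υ ν) ∂(P.bind T))
    (Q : Measure (Measure X)) (hconst : ∀ᵐ ν ∂(P.bind T), Υ ν = Q)
    (f g : X → ℝ) (hf : MemU f) (hg : MemU g) (hgf : ∀ x, g x ≤ f x)
    (hsupp : momentMeasure P (Function.support g) ≠ ∞) :
    laplaceT P (fun x => -Real.log ((1 - q) * Real.exp (-g x) + q * Real.exp (-f x))) =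
      laplaceT (P.bind T) f * laplaceT Q g := by
  obtain ⟨hq0, hq1⟩ := hq
  let h : Measure X × Measure X → ℝ≥0∞ := fun p => expNeg (pairing f p.1) * expNeg (pairing g p.2)
  have hh : Measurable h := ((measurable_expNeg_pairing hf.1).comp measurable_fst).mul
    ((measurable_expNeg_pairing hg.1).comp measurable_snd)
  have h1 : ∫⁻ p, h p ∂S = laplaceT (P.bind T) f * laplaceT Q g := by
    rw [hdis h hh]
    have : ∀ᵐ ν ∂(P.bind T), ∫⁻ η, h (ν, η) ∂(Υ ν) = expNeg (pairing f ν) * laplaceT Q g := by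
      filter_upwards [hconst] with ν hν
      rw [hν]
      exact lintegral_const_mul (expNeg (pairing f ν)) (measurable_expNeg_pairing hg.1)
    rw [lintegral_congr_ae this, lintegral_mul_const _ (measurable_expNeg_pairing hf.1)]
    rfl
  rw [← h1, hS h hh]
  have hfin : ∀ᵐ μ ∂P, μ (Function.support g) < ∞ := by
    have hs := measurableSet_support hg.1
    refine ae_lt_top (Measure.measurable_coe hs) ?_
    rw [momentMeasure, Measure.bind_apply hs measurable_id.aemeasurable] at hsupp
    exact hsupp
  have hfg : MemU (fun x => f x - g x) := by
    obtain ⟨a1, a2, ⟨C, a3⟩, a4⟩ := hf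
    refine ⟨a1.sub hg.1, fun x => sub_nonneg.2 (hgf x), ⟨C, fun x => ?_⟩, a4.subset ?_⟩
    · linarith [hg.2.1 x, a3 x]
    · intro x hx hx'
      refine hx ?_
      have := hgf x; have := hg.2.1 x
      change f x - g x = 0
      linarith
  refine lintegral_congr_ae ?_
  filter_upwards [hP, hfin] with μ hμ hμf
  obtain ⟨hTp, hTs, hTl⟩ := hT μ hμ
  have e1 : ∀ᵐ ν ∂(T μ), h (ν, μ - ν) =
      expNeg (pairing g μ) * expNeg (pairing (fun x => f x - g x) ν) := by
    filter_upwards [hTs] with ν hν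
    change expNeg _ * expNeg _ = _
    rw [← expNeg_add, ← expNeg_add, ← pairing_sub hν.2 hg.1 hμf.ne]
    congr 1
    have : pairing f ν = pairing g ν + pairing (fun x => f x - g x) ν := by
      rw [← pairing_add hg.1 hg.2.1 hfg.2.1]
      congr 1; ext x; ring
    rw [this]; ring
  rw [lintegral_congr_ae e1, lintegral_const_mul _ (measurable_expNeg_pairing hfg.1)]
  have e2 := hTl _ hfg
  rw [laplaceT] at e2
  rw [e2, ← expNeg_add]
  congr 1
  have hpos : ∀ x, 0 < 1 - q + q * Real.exp (-(f x - g x)) := fun x => by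
    have := mul_pos hq0 (Real.exp_pos (-(f x - g x))); linarith
  have e3 := pairing_add (g := fun x => -Real.log (1 - q + q * Real.exp (-(f x - g x)))) hg.1
    hg.2.1 (fun x => ?_) μ
  · rw [pairing] at e3
    refine Eq.trans ?_ e3
    rw [pairing]
    refine lintegral_congr fun x => ?_
    congr 1
    have : (1 - q) * Real.exp (-g x) + q * Real.exp (-f x) =
        Real.exp (-g x) * (1 - q + q * Real.exp (-(f x - g x))) := by
      have : Real.exp (-f x) = Real.exp (-g x) * Real.exp (-(f x - g x)) := by
        rw [← Real.exp_add]; ring_nf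
      rw [this]; ring
    rw [this, Real.log_mul (Real.exp_pos _).ne' (hpos x).ne', Real.log_exp]
    ring
  · have h1 : Real.exp (-(f x - g x)) ≤ 1 :=
      Real.exp_le_one_iff.2 (by linarith [hgf x])
    have := Real.log_nonpos (hpos x).le (by nlinarith)
    linarith

/-- The three Laplace functionals. -/
theorem laplace_main (P : Measure (Measure X)) [IsProbabilityMeasure P]
    (hP : ∀ᵐ μ ∂P, IsPointMeasure μ)
    (q : ℝ) (hq : q ∈ Set.Ioo (0 : ℝ) 1)
    (T : Measure X → Measure (Measure X)) (hTm : Measurable T)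
    (hT : ∀ μ, IsPointMeasure μ → IsThinning q μ (T μ))
    (Q : Measure (Measure X))
    (hsplit : ∀ f g : X → ℝ, MemU f → MemU g → (∀ x, g x ≤ f x) →
      momentMeasure P (Function.support g) ≠ ∞ →
      laplaceT P (fun x => -Real.log ((1 - q) * Real.exp (-g x) + q * Real.exp (-f x))) =
      laplaceT (P.bind T) f * laplaceT Q g)
    (f : X → ℝ) (hf : MemU f) (hsupp : momentMeasure P (Function.support f) ≠ ∞) :
    ∃ M : ℝ, 0 ≤ M ∧ pairing (fun x => 1 - Real.exp (-f x)) (momentMeasure P) = ENNReal.ofReal M ∧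
      (∀ s, 0 ≤ s → s ≤ 1 →
        laplaceT P (fun x => -Real.log (1 - s * (1 - Real.exp (-f x)))) =
          ENNReal.ofReal (Real.exp (-(s * M)))) ∧
      laplaceT Q f = ENNReal.ofReal (Real.exp (-((1 - q) * M))) := by
  have hq' := hq
  obtain ⟨hq0, hq1⟩ := hq
  obtain ⟨hfm, hf0, ⟨C, hfC⟩, hfb⟩ := id hf
  set c : ℝ := 1 - Real.exp (-(|C| + 1)) with hc
  have hc1 : c < 1 := by have := Real.exp_pos (-(|C| + 1)); linarith
  have hc0 : 0 < c := by
    have : Real.exp (-(|C| + 1)) < 1 := Real.exp_lt_one_iff.2 (by have := abs_nonneg C; linarith)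
    linarith
  let w : X → ℝ := fun x => (1 - Real.exp (-f x)) / c
  have hwm : Measurable w := (measurable_const.sub (Real.measurable_exp.comp hfm.neg)).div_const c
  have hcw : ∀ x, c * w x = 1 - Real.exp (-f x) := fun x => mul_div_cancel₀ _ hc0.ne'
  have hw0 : ∀ x, 0 ≤ w x := fun x => by
    have := Real.exp_le_one_iff.2 (neg_nonpos.2 (hf0 x))
    exact div_nonneg (by linarith) hc0.le
  have hw1 : ∀ x, w x ≤ 1 := fun x => by
    change _ / c ≤ 1
    rw [div_le_one hc0, hc]
    have : Real.exp (-(|C| + 1)) ≤ Real.exp (-f x) :=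
      Real.exp_le_exp.2 (by have := hfC x; have := le_abs_self C; linarith)
    linarith
  have hws : Function.support w ⊆ Function.support f := by
    intro x hx hx'
    exact hx (by simp [w, hx'])
  have hwb := hfb.subset hws
  have hfin : pairing w (momentMeasure P) ≠ ∞ := by
    have : pairing w (momentMeasure P) ≤ momentMeasure P (Function.support f) := by
      rw [← lintegral_indicator_one (measurableSet_support hfm)]
      refine lintegral_mono fun x => ?_
      by_cases hx : x ∈ Function.support f
      · rw [Set.indicator_of_mem hx]; simpa using hw1 x
      · have : w x = 0 := by by_contra h; exact hx (hws h)
        simp [this]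
    exact (this.trans_lt hsupp.lt_top).ne
  have hU := fun t (h0 : 0 ≤ t) (h1 : t < 1) => memU_nlog h0 h1 hwm hw0 hw1 hwb
  have hbind : ∀ t, 0 ≤ t → t < 1 →
      laplaceT (P.bind T) (nlog t w) = laplaceT P (nlog (q * t) w) := by
    intro t h0 h1
    rw [laplace_bind hTm hP hT _ (hU t h0 h1).1]
    congr 1; ext x
    rw [exp_neg_nlog h0 h1 (hw1 x), nlog]
    ring_nf
  have hsp : ∀ x y, 0 ≤ y → y ≤ x → x < 1 → laplaceT P (nlog (q * x + (1 - q) * y) w) =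
      laplaceT P (nlog (q * x) w) * laplaceT Q (nlog y w) := by
    intro x y hy hyx hx
    rw [← hbind x (by linarith) hx, ← hsplit _ _ (hU x (by linarith) hx).1
      (hU y hy (by linarith)).1 (fun z => nlog_mono hy hyx hx (hw0 z) (hw1 z))]
    · congr 1; ext z
      rw [exp_neg_nlog (by linarith) hx (hw1 z), exp_neg_nlog hy (by linarith) (hw1 z), nlog]
      ring_nf
    · refine ((measure_mono ?_).trans_lt hsupp.lt_top).ne
      exact (hU y hy (by linarith)).2.trans hws
  have hsp' : ∀ y, 0 ≤ y → y < 1 → laplaceT P (nlog y w) =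
      laplaceT P (nlog (q * y) w) * laplaceT Q (nlog y w) := by
    intro y h0 h1
    have := hsp y y h0 le_rfl h1
    rwa [show q * y + (1 - q) * y = y by ring] at this
  have hcore := core P w hwm hw0 hw1 hfin q hq' (fun x y hy hyx hx => by
    rw [hsp x y hy hyx hx, hsp' y hy (by linarith)]; ring)
  set m := (pairing w (momentMeasure P)).toReal with hm
  have hm0 : 0 ≤ m := ENNReal.toReal_nonneg
  have hff : nlog c w = f := by
    ext x; rw [nlog, hcw]; simp
  refine ⟨c * m, mul_nonneg hc0.le hm0, ?_, ?_, ?_⟩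
  · simp_rw [← hcw]
    rw [pairing_smul hc0.le hwm, ENNReal.ofReal_mul hc0.le, hm, ENNReal.ofReal_toReal hfin]
  · intro s hs0 hs1
    have := hcore (s * c) (by positivity) (by nlinarith)
    rw [show s * (c * m) = s * c * m by ring, ← this]
    congr 1; ext x
    rw [nlog, ← hcw, mul_assoc]
  · have h1 := hsp' c hc0.le hc1
    rw [hcore c hc0.le hc1, hcore (q * c) (by positivity) (by nlinarith), hff] at h1
    have h2 : ENNReal.ofReal (Real.exp (-(c * m))) = ENNReal.ofReal (Real.exp (-(q * c * m))) *
        ENNReal.ofReal (Real.exp (-((1 - q) * (c * m)))) := by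
      rw [← ENNReal.ofReal_mul (Real.exp_pos _).le, ← Real.exp_add]
      congr 2; ring
    rw [h2] at h1
    exact ((ENNReal.mul_right_inj (by simp [Real.exp_pos]) (by simp)).1 h1).symm

end Main
end PoissonSplitting
open MeasureTheory ENNReal PoissonSplitting

/-- If the splitting kernel `Υ^ν_q(P)` of a first-order point process `P` does not depend
on the observed configuration `ν`, i.e. `Υ^ν_q(P) = Q` for `Γ_q(P)`-almost all `ν`, then
`P` is a Poisson point process: `P = Π_{ν_P}`, and `Q = Γ_{1-q}(P) = Π_{(1-q) ν_P}`. -/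
theorem statement10 {X : Type*} [MeasurableSpace X] [MetricSpace X] [PolishSpace X]
    [BorelSpace X] (P : Measure (Measure X)) (hP : IsPointProcess P)
    (hP1 : IsFirstOrder P) (q : ℝ) (hq : q ∈ Set.Ioo (0 : ℝ) 1)
    (T T' : Measure X → Measure (Measure X)) (hTm : Measurable T) (hT'm : Measurable T')
    (hT : ∀ μ, IsPointMeasure μ → IsThinning q μ (T μ))
    (hT' : ∀ μ, IsPointMeasure μ → IsThinning (1 - q) μ (T' μ))
    (S : Measure (Measure X × Measure X))
    (hS : ∀ h : Measure X × Measure X → ℝ≥0∞, Measurable h →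
      ∫⁻ p, h p ∂S = ∫⁻ μ, ∫⁻ ν, h (ν, μ - ν) ∂(T μ) ∂P)
    (Υ : ProbabilityTheory.Kernel (Measure X) (Measure X))
    (hΥ : ProbabilityTheory.IsMarkovKernel Υ)
    (hdis : ∀ h : Measure X × Measure X → ℝ≥0∞, Measurable h →
      ∫⁻ p, h p ∂S = ∫⁻ ν, ∫⁻ η, h (ν, η) ∂(Υ ν) ∂(P.bind T))
    (Q : Measure (Measure X)) (hQ : IsPointProcess Q)
    (hconst : ∀ᵐ ν ∂(P.bind T), Υ ν = Q) :
    IsPoissonPP (momentMeasure P) P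
      ∧ Q = P.bind T'
      ∧ IsPoissonPP (ENNReal.ofReal (1 - q) • momentMeasure P) Q := by
  obtain ⟨hPp, hPa⟩ := hP
  obtain ⟨hQp, hQa⟩ := hQ
  have : IsLocallyFiniteMeasure (momentMeasure P) := hP1
  obtain ⟨B, hBm, hBmono, hBU, hBb, hBf⟩ := exists_exhaustion (momentMeasure P)
  have hmain := laplace_main P hPa q hq T hTm hT Q
    (laplace_split P hPa q hq T hT S hS Υ hdis Q hconst)
  have hsup : ∀ f : X → ℝ, (∃ n, Function.support f ⊆ B n) →
      momentMeasure P (Function.support f) ≠ ∞ := by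
    rintro f ⟨n, hn⟩
    exact ((measure_mono hn).trans_lt (hBf n)).ne
  have h1q : 0 ≤ 1 - q := by linarith [hq.2]
  have hT'p : IsProbabilityMeasure (P.bind T') := by
    refine ⟨?_⟩
    rw [Measure.bind_apply MeasurableSet.univ hT'm.aemeasurable]
    have : ∀ᵐ μ ∂P, T' μ Set.univ = 1 := by
      filter_upwards [hPa] with μ hμ
      exact (hT' μ hμ).1.measure_univ
    rw [lintegral_congr_ae this]; simp
  refine ⟨⟨hPp, hPa, ?_⟩, ?_, ⟨hQp, hQa, ?_⟩⟩
  · refine laplace_of_trunc hBm hBmono hBU P _ fun f hf hn => ?_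
    obtain ⟨M, hM0, hM, hs, -⟩ := hmain f hf (hsup f hn)
    rw [hM, expNeg_ofReal hM0]
    have := hs 1 zero_le_one le_rfl
    simpa using this
  · refine ext_of_laplace Q (P.bind T') B hBm hBmono hBU hBb fun f hf hn => ?_
    obtain ⟨M, hM0, hM, hs, hQf⟩ := hmain f hf (hsup f hn)
    rw [hQf, laplace_bind hT'm hPa hT' f hf, ← hs (1 - q) h1q (by linarith [hq.1])]
    congr 1; ext x; ring_nf
  · refine laplace_of_trunc hBm hBmono hBU Q _ fun f hf hn => ?_
    obtain ⟨M, hM0, hM, hs, hQf⟩ := hmain f hf (hsup f hn)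
    rw [hQf, ← expNeg_ofReal (mul_nonneg h1q hM0), ENNReal.ofReal_mul h1q, ← hM]
    congr 1
    rw [pairing, pairing, lintegral_smul_measure, smul_eq_mul]
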